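/- Solution of the transport (cohomological) equation by characteristics: let ν ∈ ℝ, λ > 0, and let 𝒦: ℝ³ → ℝ, written 𝒦(s, p, g), be continuous with 𝒦(s, 0, g) = 0 for all (s, g), and uniformly Lipschitz in p: there is C ≥ 0 with |𝒦(s, p, g) − 𝒦(s, p', g)| ≤ C|p − p'| for all s, p, p', g. Then for every (s, p, g) the integral W(s, p, g) := −∫₀^{∞} 𝒦(s + νσ, p e^{−λσ}, g + σ) dσ converges absolutely, |W(s, p, g)| ≤ C|p|/λ, and for every (s, p, g) the function h ↦ W(s + νh, p e^{−λh}, g + h) is differentiable on ℝ with derivative 𝒦(s + νh, p e^{−λh}, g + h) at every h; that is, the derivative of W along the vector field (ν, −λp, 1) equals 𝒦. -/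

import Mathlib

open MeasureTheory

/-- The solution of the transport (cohomological) equation by the characteristics
method: `W(s, p, g) = −∫₀^∞ 𝒦(s + νσ, p e^{−λσ}, g + σ) dσ`. -/
noncomputable def transportW (ν lam : ℝ) (K : ℝ → ℝ → ℝ → ℝ) (s p g : ℝ) : ℝ :=
  -∫ σ in Set.Ioi (0 : ℝ), K (s + ν * σ) (p * Real.exp (-lam * σ)) (g + σ)

/-- A continuous function dominated by a multiple of a decaying exponential is integrable on
every right half-line. -/
theorem integrableOn_Ioi_of_abs_le_exp {F : ℝ → ℝ} {M b : ℝ} (hF : Continuous F) (hb : 0 < b)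
    (hbound : ∀ x, |F x| ≤ M * Real.exp (-b * x)) (a : ℝ) : IntegrableOn F (Set.Ioi a) :=
  ((exp_neg_integrableOn_Ioi a hb).const_mul M).mono' hF.aestronglyMeasurable
    (Filter.Eventually.of_forall hbound)

/-- The integral of an exponentially dominated function over `(0, ∞)` is at most the integral
of its dominating exponential. -/
theorem abs_integral_Ioi_zero_le_of_abs_le_exp {F : ℝ → ℝ} {M b : ℝ} (hb : 0 < b)
    (hbound : ∀ x, |F x| ≤ M * Real.exp (-b * x)) :
    |∫ x in Set.Ioi (0 : ℝ), F x| ≤ M / b := by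
  have h := norm_integral_le_of_norm_le (f := F)
    ((exp_neg_integrableOn_Ioi 0 hb).const_mul M) (Filter.Eventually.of_forall hbound)
  rw [integral_const_mul, integral_exp_mul_Ioi (neg_lt_zero.mpr hb)] at h
  simpa [div_eq_mul_inv] using h

/-- Translating the integrand translates the right half-line of integration. -/
theorem integral_Ioi_zero_comp_add_right (F : ℝ → ℝ) (h : ℝ) :
    ∫ x in Set.Ioi (0 : ℝ), F (x + h) = ∫ x in Set.Ioi h, F x := by
  have := (measurePreserving_add_right volume h).setIntegral_preimage_emb
    (measurableEmbedding_addRight h) F (Set.Ioi h)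
  simpa using this

/-- The tail integral of a continuous function has derivative minus the function. -/
theorem hasDerivAt_integral_Ioi {F : ℝ → ℝ} (hF : Continuous F)
    (hint : ∀ a, IntegrableOn F (Set.Ioi a)) (h : ℝ) :
    HasDerivAt (fun a => ∫ x in Set.Ioi a, F x) (-F h) h := by
  have heq : (fun a => ∫ x in Set.Ioi a, F x) =
      fun a => (∫ x in Set.Ioi (0 : ℝ), F x) - ∫ x in (0 : ℝ)..a, F x := by
    funext a
    rw [← intervalIntegral.integral_interval_add_Ioi (hint 0) (hint a), add_sub_cancel_left]
  rw [heq]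
  exact (hF.integral_hasStrictDerivAt 0 h).hasDerivAt.const_sub _

/-- Solution of the transport (cohomological) equation by characteristics: if `𝒦`
is continuous, vanishes at `p = 0`, and is uniformly Lipschitz in `p` with constant
`C`, then the integral defining `W` converges absolutely, `|W| ≤ C|p|/λ`, and `W`
is differentiable along the characteristic vector field `(ν, −λp, 1)` with derivative
equal to `𝒦`. -/
theorem transport_equation_characteristics
    (ν lam : ℝ) (hlam : 0 < lam)
    (K : ℝ → ℝ → ℝ → ℝ)
    (hKcont : Continuous fun z : ℝ × ℝ × ℝ => K z.1 z.2.1 z.2.2)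
    (hKzero : ∀ s g : ℝ, K s 0 g = 0)
    (C : ℝ) (hC : 0 ≤ C)
    (hKlip : ∀ s p p' g : ℝ, |K s p g - K s p' g| ≤ C * |p - p'|) :
    ∀ s p g : ℝ,
      IntegrableOn (fun σ => K (s + ν * σ) (p * Real.exp (-lam * σ)) (g + σ)) (Set.Ioi 0)
      ∧ |transportW ν lam K s p g| ≤ C * |p| / lam
      ∧ ∀ h : ℝ,
          HasDerivAt
            (fun h' => transportW ν lam K (s + ν * h') (p * Real.exp (-lam * h')) (g + h'))
            (K (s + ν * h) (p * Real.exp (-lam * h)) (g + h)) h := by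
  intro s p g
  set F : ℝ → ℝ := fun σ => K (s + ν * σ) (p * Real.exp (-lam * σ)) (g + σ) with hFdef
  have hF : Continuous F := hKcont.comp
    (f := fun σ : ℝ => (s + ν * σ, p * Real.exp (-lam * σ), g + σ)) (by fun_prop)
  have hbound : ∀ σ, |F σ| ≤ C * |p| * Real.exp (-lam * σ) := by
    intro σ
    have h := hKlip (s + ν * σ) (p * Real.exp (-lam * σ)) 0 (g + σ)
    rwa [hKzero, sub_zero, sub_zero, abs_mul, Real.abs_exp, ← mul_assoc] at h
  have hint := integrableOn_Ioi_of_abs_le_exp hF hlam hbound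
  refine ⟨hint 0, ?_, fun h => ?_⟩
  · rw [transportW, abs_neg]
    exact abs_integral_Ioi_zero_le_of_abs_le_exp hlam hbound
  · have hflow : (fun h' => transportW ν lam K (s + ν * h') (p * Real.exp (-lam * h')) (g + h')) =
        fun h' => -∫ x in Set.Ioi h', F x := by
      funext h'
      rw [transportW, ← integral_Ioi_zero_comp_add_right F h']
      congr 2
      funext σ
      simp only [hFdef]
      rw [mul_assoc, ← Real.exp_add]
      congr 1 <;> ring_nf
    rw [hflow]
    have hderiv := (hasDerivAt_integral_Ioi hF hint h).fun_neg
    rwa [neg_neg] at hderiv
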